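/- Let ξ, τ be commuting Killing fields on a 4-dimensional Lorentzian manifold, set σ = ξ ∧ τ, and suppose ρ² = −‖σ‖² > 0. If σ · δdσ = 0 (which holds for solutions of the Einstein/Maxwell equations whose fields are tangent to the orbits), then Δ_g ρ = ρ^{−1} ‖dρ‖², where 2ρ dρ = −∗(∗dσ ∧ σ); equivalently, ρ is harmonic with respect to the quotient 2-metric h: Δ_h ρ = 0. -/

import Mathlib

/-!
STATEMENT 12: for commuting Killing fields `ξ, τ` on a 4-dimensional
Lorentzian manifold with `σ = ξ♭ ∧ τ♭` and `ρ² = −‖σ‖² > 0`, if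
`σ · δdσ = 0` (as holds for Einstein/Maxwell solutions whose fields are
tangent to the orbits) and the distribution orthogonal to the orbits is
integrable (`i_ξ ∗dσ = i_τ ∗dσ = 0`, which is what makes
`‖dσ‖² = −4‖dρ‖²` valid), then `Δ_g ρ = ρ^{-1} ‖dρ‖²`,
i.e. `ρ` is harmonic for the quotient metric.

Everything is written in components on an open set `Ω ⊆ ℝ⁴`; `δ` is the
codifferential (`(δ dσ)^{bc} = −(1/√|g|) ∂_a (√|g| (dσ)^{abc})`), and
`Δ_g f = (1/√|g|) ∂_a (√|g| g^{ab} ∂_b f)` is the Laplace–Beltrami operator.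
-/

open MeasureTheory

noncomputable section

abbrev E4 := EuclideanSpace ℝ (Fin 4)

/-- Partial derivative `∂_i f(x)`. -/
noncomputable def pd (i : Fin 4) (f : E4 → ℝ) (x : E4) : ℝ :=
  fderiv ℝ f x (EuclideanSpace.single i (1 : ℝ))

/-- The inverse metric `g^{μν}`. -/
noncomputable def ginv (g : E4 → Matrix (Fin 4) (Fin 4) ℝ) (x : E4) :
    Matrix (Fin 4) (Fin 4) ℝ := (g x)⁻¹

/-- The metric volume density `√|det g|`. -/
noncomputable def vol (g : E4 → Matrix (Fin 4) (Fin 4) ℝ) (x : E4) : ℝ :=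
  Real.sqrt |(g x).det|

/-- The Levi-Civita permutation symbol `ε_{abcd}` (`= det of the matrix of the
corresponding standard basis vectors`). -/
noncomputable def epsSymb (a b c d : Fin 4) : ℝ :=
  Matrix.det (Matrix.of fun i j => if (![a, b, c, d] i) = j then (1 : ℝ) else 0)

/-- Christoffel symbols `Γ^s_{μν}` of the metric `g`. -/
noncomputable def Christoffel (g : E4 → Matrix (Fin 4) (Fin 4) ℝ)
    (x : E4) (s μ ν : Fin 4) : ℝ :=
  (1 / 2) * ∑ l, ginv g x s l *
    (pd μ (fun y => g y ν l) x + pd ν (fun y => g y μ l) x - pd l (fun y => g y μ ν) x)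

/-- The Ricci tensor `R_{μν}` of the metric `g`. -/
noncomputable def RicciT (g : E4 → Matrix (Fin 4) (Fin 4) ℝ)
    (x : E4) (μ ν : Fin 4) : ℝ :=
  (∑ s, (pd s (fun y => Christoffel g y s μ ν) x - pd μ (fun y => Christoffel g y s s ν) x)) +
    ∑ s, ∑ l, (Christoffel g x s s l * Christoffel g x l μ ν -
      Christoffel g x s μ l * Christoffel g x l s ν)

/-- `‖F‖² = (1/2) F^{ab} F_{ab}`. -/
noncomputable def normF2 (g F : E4 → Matrix (Fin 4) (Fin 4) ℝ) (x : E4) : ℝ :=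
  (1 / 2) * ∑ a, ∑ b, ∑ c, ∑ d, ginv g x a c * ginv g x b d * F x a b * F x c d

/-- The electromagnetic energy-momentum tensor
`T_F(∂_μ,∂_ν) = i_{∂_μ}F · i_{∂_ν}F − (1/2)‖F‖² g_{μν}`. -/
noncomputable def TF (g F : E4 → Matrix (Fin 4) (Fin 4) ℝ) (x : E4) (μ ν : Fin 4) : ℝ :=
  (∑ a, ∑ b, ginv g x a b * F x μ a * F x ν b) - (1 / 2) * normF2 g F x * g x μ ν

/-- The Hodge dual `(∗F)_{μν} = (1/2) F^{ab} ε_{abμν}` of a 2-form, with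
`ε = √|det g| ·` (permutation symbol). -/
noncomputable def star2 (g F : E4 → Matrix (Fin 4) (Fin 4) ℝ) (x : E4) (μ ν : Fin 4) : ℝ :=
  (vol g x / 2) * ∑ a, ∑ b,
    (∑ c, ∑ d, ginv g x a c * ginv g x b d * F x c d) * epsSymb a b μ ν

/-- The Hodge dual `(∗W)_μ = (1/3!) W^{abc} ε_{abcμ}` of a 3-form `W`. -/
noncomputable def star3 (g : E4 → Matrix (Fin 4) (Fin 4) ℝ)
    (W : E4 → Fin 4 → Fin 4 → Fin 4 → ℝ) (x : E4) (μ : Fin 4) : ℝ :=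
  (vol g x / 6) * ∑ a, ∑ b, ∑ c,
    (∑ p, ∑ q, ∑ r, ginv g x a p * ginv g x b q * ginv g x c r * W x p q r) *
      epsSymb a b c μ

/-- The metric-dual 1-form `ξ_μ = g_{μν} ξ^ν` of the vector field `ξ`. -/
noncomputable def formOf (g : E4 → Matrix (Fin 4) (Fin 4) ℝ) (ξ : E4 → Fin 4 → ℝ)
    (x : E4) (μ : Fin 4) : ℝ := ∑ ν, g x μ ν * ξ x ν

/-- `(dξ)_{μν}` for the 1-form `ξ^♭`. -/
noncomputable def dform (g : E4 → Matrix (Fin 4) (Fin 4) ℝ) (ξ : E4 → Fin 4 → ℝ)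
    (x : E4) (μ ν : Fin 4) : ℝ :=
  pd μ (fun y => formOf g ξ y ν) x - pd ν (fun y => formOf g ξ y μ) x

/-- The Lie derivative `(L_ξ T)_{μν}` of a covariant 2-tensor `T`. -/
noncomputable def lieD (ξ : E4 → Fin 4 → ℝ) (T : E4 → Matrix (Fin 4) (Fin 4) ℝ)
    (x : E4) (μ ν : Fin 4) : ℝ :=
  ∑ s, (ξ x s * pd s (fun y => T y μ ν) x + T x s ν * pd μ (fun y => ξ y s) x +
    T x μ s * pd ν (fun y => ξ y s) x)

/-- The inner product `g(X, Y)` of two vector fields. -/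
noncomputable def ipg (g : E4 → Matrix (Fin 4) (Fin 4) ℝ) (X Y : E4 → Fin 4 → ℝ)
    (x : E4) : ℝ := ∑ μ, ∑ ν, g x μ ν * X x μ * Y x ν

/-- The 2-form `σ = ξ♭ ∧ τ♭`. -/
noncomputable def sigmaForm (g : E4 → Matrix (Fin 4) (Fin 4) ℝ)
    (ξ τ : E4 → Fin 4 → ℝ) (x : E4) (μ ν : Fin 4) : ℝ :=
  formOf g ξ x μ * formOf g τ x ν - formOf g ξ x ν * formOf g τ x μ

/-- `ρ = √((ξ·τ)² − ‖ξ‖²‖τ‖²) = √(−‖σ‖²)`. -/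
noncomputable def rhoF (g : E4 → Matrix (Fin 4) (Fin 4) ℝ)
    (ξ τ : E4 → Fin 4 → ℝ) (x : E4) : ℝ :=
  Real.sqrt (ipg g ξ τ x ^ 2 - ipg g ξ ξ x * ipg g τ τ x)

/-- The 3-form `dσ`. -/
noncomputable def dsigma (g : E4 → Matrix (Fin 4) (Fin 4) ℝ)
    (ξ τ : E4 → Fin 4 → ℝ) (x : E4) (a b c : Fin 4) : ℝ :=
  pd a (fun y => sigmaForm g ξ τ y b c) x + pd b (fun y => sigmaForm g ξ τ y c a) x +
    pd c (fun y => sigmaForm g ξ τ y a b) x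

/-- `(dσ)^{abc}` with all indices raised. -/
noncomputable def dsigmaUp (g : E4 → Matrix (Fin 4) (Fin 4) ℝ)
    (ξ τ : E4 → Fin 4 → ℝ) (x : E4) (a b c : Fin 4) : ℝ :=
  ∑ p, ∑ q, ∑ r, ginv g x a p * ginv g x b q * ginv g x c r * dsigma g ξ τ x p q r

/-- `(δ dσ)^{bc} = −(1/√|g|) ∂_a (√|g| (dσ)^{abc})`. -/
noncomputable def deltaDsigmaUp (g : E4 → Matrix (Fin 4) (Fin 4) ℝ)
    (ξ τ : E4 → Fin 4 → ℝ) (x : E4) (b c : Fin 4) : ℝ :=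
  -(vol g x)⁻¹ * ∑ a, pd a (fun y => vol g y * dsigmaUp g ξ τ y a b c) x

/-- The Laplace–Beltrami operator `Δ_g f = (1/√|g|) ∂_a (√|g| g^{ab} ∂_b f)`. -/
noncomputable def lapBeltrami (g : E4 → Matrix (Fin 4) (Fin 4) ℝ)
    (f : E4 → ℝ) (x : E4) : ℝ :=
  (vol g x)⁻¹ * ∑ a, pd a (fun y => vol g y * ∑ b, ginv g y a b * pd b f y) x

open scoped ContDiff Topology

section PartialDerivatives

variable {f h : E4 → ℝ} {x : E4} (i : Fin 4)

lemma pd_congr (hfh : f =ᶠ[𝓝 x] h) : pd i f x = pd i h x := by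
  simp only [pd, hfh.fderiv_eq]

lemma pd_neg : pd i (fun y => -f y) x = -pd i f x := by
  simp [pd, fderiv_fun_neg]

lemma pd_sub (hf : DifferentiableAt ℝ f x) (hh : DifferentiableAt ℝ h x) :
    pd i (fun y => f y - h y) x = pd i f x - pd i h x := by
  simp [pd, fderiv_fun_sub hf hh]

lemma pd_mul (hf : DifferentiableAt ℝ f x) (hh : DifferentiableAt ℝ h x) :
    pd i (fun y => f y * h y) x = pd i f x * h x + f x * pd i h x := by
  simp [pd, fderiv_fun_mul hf hh]; ring

lemma pd_sum {ι : Type*} (s : Finset ι) {F : ι → E4 → ℝ}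
    (hF : ∀ j ∈ s, DifferentiableAt ℝ (F j) x) :
    pd i (fun y => ∑ j ∈ s, F j y) x = ∑ j ∈ s, pd i (F j) x := by
  simp [pd, fderiv_fun_sum hF]

lemma pd_sqrt (hf : DifferentiableAt ℝ f x) (hx : f x ≠ 0) :
    pd i (fun y => √(f y)) x = pd i f x / (2 * √(f x)) := by
  simp [pd, fderiv_sqrt hf hx]; ring

lemma contDiffAt_pd (hf : ContDiffAt ℝ ∞ f x) : ContDiffAt ℝ ∞ (pd i f) x :=
  (hf.fderiv_right (m := ∞) (by simp)).clm_apply contDiffAt_const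

end PartialDerivatives

section Smoothness

variable {g : E4 → Matrix (Fin 4) (Fin 4) ℝ} {ξ τ : E4 → Fin 4 → ℝ} {x : E4}

lemma contDiffAt_det {n : ℕ} {M : E4 → Matrix (Fin n) (Fin n) ℝ}
    (hM : ∀ i j, ContDiffAt ℝ ∞ (fun y => M y i j) x) :
    ContDiffAt ℝ ∞ (fun y => (M y).det) x := by
  simp only [Matrix.det_apply']
  exact ContDiffAt.sum fun p _ => contDiffAt_const.mul (contDiffAt_prod fun i _ => hM _ _)

lemma contDiffAt_ginv (hg : ∀ μ ν, ContDiffAt ℝ ∞ (fun y => g y μ ν) x)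
    (hdet : (g x).det ≠ 0) (a b : Fin 4) :
    ContDiffAt ℝ ∞ (fun y => ginv g y a b) x := by
  simp only [ginv, Matrix.inv_def, Ring.inverse_eq_inv', Matrix.smul_apply, smul_eq_mul,
    Matrix.adjugate_apply]
  refine ((contDiffAt_det hg).inv hdet).mul (contDiffAt_det fun i j => ?_)
  by_cases hi : i = b
  · subst hi
    simpa using contDiffAt_const
  · simpa [Matrix.updateRow_ne hi] using hg i j

lemma contDiffAt_vol (hg : ∀ μ ν, ContDiffAt ℝ ∞ (fun y => g y μ ν) x)
    (hdet : (g x).det ≠ 0) : ContDiffAt ℝ ∞ (vol g) x :=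
  ((contDiffAt_det hg).abs hdet).sqrt (abs_ne_zero.mpr hdet)

lemma contDiffAt_formOf (hg : ∀ μ ν, ContDiffAt ℝ ∞ (fun y => g y μ ν) x)
    (hξ : ∀ μ, ContDiffAt ℝ ∞ (fun y => ξ y μ) x) (μ : Fin 4) :
    ContDiffAt ℝ ∞ (fun y => formOf g ξ y μ) x :=
  ContDiffAt.sum fun ν _ => (hg μ ν).mul (hξ ν)

lemma contDiffAt_sigmaForm (hg : ∀ μ ν, ContDiffAt ℝ ∞ (fun y => g y μ ν) x)
    (hξ : ∀ μ, ContDiffAt ℝ ∞ (fun y => ξ y μ) x)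
    (hτ : ∀ μ, ContDiffAt ℝ ∞ (fun y => τ y μ) x) (μ ν : Fin 4) :
    ContDiffAt ℝ ∞ (fun y => sigmaForm g ξ τ y μ ν) x :=
  ((contDiffAt_formOf hg hξ μ).mul (contDiffAt_formOf hg hτ ν)).sub
    ((contDiffAt_formOf hg hξ ν).mul (contDiffAt_formOf hg hτ μ))

lemma contDiffAt_dsigmaUp (hg : ∀ μ ν, ContDiffAt ℝ ∞ (fun y => g y μ ν) x)
    (hdet : (g x).det ≠ 0) (hξ : ∀ μ, ContDiffAt ℝ ∞ (fun y => ξ y μ) x)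
    (hτ : ∀ μ, ContDiffAt ℝ ∞ (fun y => τ y μ) x) (a b c : Fin 4) :
    ContDiffAt ℝ ∞ (fun y => dsigmaUp g ξ τ y a b c) x := by
  have hσ (i μ ν : Fin 4) := contDiffAt_pd i (contDiffAt_sigmaForm hg hξ hτ μ ν)
  have hi := contDiffAt_ginv hg hdet
  exact ContDiffAt.sum fun p _ => ContDiffAt.sum fun q _ => ContDiffAt.sum fun r _ =>
    (((hi a p).mul (hi b q)).mul (hi c r)).mul
      (((hσ p q r).add (hσ q r p)).add (hσ r p q))

end Smoothness

section Trilinear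

variable {V W : Fin 4 → Fin 4 → Fin 4 → ℝ}

lemma sum_rotate (F : Fin 4 → Fin 4 → Fin 4 → ℝ) :
    ∑ a, ∑ b, ∑ c, F b c a = ∑ a, ∑ b, ∑ c, F a b c := by
  rw [Finset.sum_comm]
  exact Finset.sum_congr rfl fun b _ => Finset.sum_comm

lemma epsSymb_eq (a b c d : Fin 4) :
    epsSymb a b c d = ((b : ℝ) - a) * (c - a) * (d - a) * (c - b) * (d - b) * (d - c) / 12 := by
  have h : (Matrix.of fun i j => if (![a, b, c, d] i) = j then (1 : ℝ) else 0) *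
      Matrix.vandermonde (fun j : Fin 4 => (j : ℝ)) =
      Matrix.vandermonde (fun i => ((![a, b, c, d] i : Fin 4) : ℝ)) := by
    ext i j
    simp [Matrix.mul_apply, Matrix.vandermonde_apply]
  have h' := congrArg Matrix.det h
  rw [Matrix.det_mul, Matrix.det_vandermonde, Matrix.det_vandermonde] at h'
  change epsSymb a b c d * _ = _ at h'
  have h0 (v : Fin 4 → ℝ) : ∏ i, ∏ j ∈ Finset.Ioi i, (v j - v i) =
      (v 1 - v 0) * (v 2 - v 0) * (v 3 - v 0) * (v 2 - v 1) * (v 3 - v 1) * (v 3 - v 2) := by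
    simp [Fin.prod_univ_succ, Fin.prod_Ioi_succ]
    ring
  rw [h0, h0] at h'
  norm_num at h'
  change _ = ((b : ℝ) - a) * (c - a) * (d - a) * (c - b) * (d - b) * (d - c) at h'
  linarith

/-- The components of the contraction of `V` with the Levi-Civita symbol. -/
def dualVec (V : Fin 4 → Fin 4 → Fin 4 → ℝ) (μ : Fin 4) : ℝ :=
  1 / 6 * ∑ a, ∑ b, ∑ c, V a b c * epsSymb a b c μ

lemma eq_zero_of_antisymm (h₁ : ∀ a b c, V b a c = -V a b c) (h₂ : ∀ a b c, V a c b = -V a b c)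
    (h012 : V 0 1 2 = 0) (h013 : V 0 1 3 = 0) (h023 : V 0 2 3 = 0) (h123 : V 1 2 3 = 0)
    (a b c : Fin 4) : V a b c = 0 := by
  have z₁ (a c : Fin 4) : V a a c = 0 := by linarith [h₁ a a c]
  have z₂ (a c : Fin 4) : V a c c = 0 := by linarith [h₂ a c c]
  have z₃ (a c : Fin 4) : V a c a = 0 := by rw [h₂, z₁, neg_zero]
  have perm (a b c : Fin 4) (h : V a b c = 0) : V b a c = 0 ∧ V a c b = 0 ∧ V b c a = 0 ∧
      V c a b = 0 ∧ V c b a = 0 := by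
    refine ⟨?_, ?_, ?_, ?_, ?_⟩ <;>
      linarith [h₁ a b c, h₂ a b c, h₂ b a c, h₁ a c b, h₂ c a b]
  have p₀ := perm _ _ _ h012
  have p₁ := perm _ _ _ h013
  have p₂ := perm _ _ _ h023
  have p₃ := perm _ _ _ h123
  fin_cases a <;> fin_cases b <;> fin_cases c <;>
    simp [z₁, z₂, z₃, h012, h013, h023, h123, p₀, p₁, p₂, p₃]

lemma dualVec_eq (h₁ : ∀ a b c, V b a c = -V a b c) (h₂ : ∀ a b c, V a c b = -V a b c) :
    dualVec V = ![-V 1 2 3, V 0 2 3, -V 0 1 3, V 0 1 2] := by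
  have s (a b c : Fin 4) : V b a c = -V a b c ∧ V a c b = -V a b c ∧ V b c a = V a b c ∧
      V c a b = V a b c ∧ V c b a = -V a b c := by
    refine ⟨?_, ?_, ?_, ?_, ?_⟩ <;>
      linarith [h₁ a b c, h₂ a b c, h₂ b a c, h₁ a c b, h₂ c a b]
  ext μ
  fin_cases μ <;> simp [dualVec, epsSymb_eq, Fin.sum_univ_four] <;>
    simp only [s 0 1 2, s 0 1 3, s 0 2 3, s 1 2 3] <;> ring

lemma mul_eq_of_dualVec (h₁ : ∀ a b c, V b a c = -V a b c)
    (h₂ : ∀ a b c, V a c b = -V a b c) {ξ τ : Fin 4 → ℝ} (n m : Fin 4 → ℝ)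
    (hξ : ∑ μ, ξ μ * dualVec V μ = 0) (hτ : ∑ μ, τ μ * dualVec V μ = 0) (a b c : Fin 4) :
    V a b c * ((∑ μ, n μ * ξ μ) * (∑ μ, m μ * τ μ) - (∑ μ, n μ * τ μ) * (∑ μ, m μ * ξ μ)) =
      (ξ a * τ b - ξ b * τ a) * (∑ p, ∑ q, n p * m q * V p q c) +
      (ξ b * τ c - ξ c * τ b) * (∑ p, ∑ q, n p * m q * V p q a) +
      (ξ c * τ a - ξ a * τ c) * (∑ p, ∑ q, n p * m q * V p q b) := by
  have z₁ (a c : Fin 4) : V a a c = 0 := by linarith [h₁ a a c]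
  have z₂ (a c : Fin 4) : V a c c = 0 := by linarith [h₂ a c c]
  have z₃ (a c : Fin 4) : V a c a = 0 := by rw [h₂, z₁, neg_zero]
  have s (a b c : Fin 4) : V b a c = -V a b c ∧ V a c b = -V a b c ∧ V b c a = V a b c ∧
      V c a b = V a b c ∧ V c b a = -V a b c := by
    refine ⟨?_, ?_, ?_, ?_, ?_⟩ <;>
      linarith [h₁ a b c, h₂ a b c, h₂ b a c, h₁ a c b, h₂ c a b]
  have k (μ : Fin 4) : (∑ ν, τ ν * dualVec V ν) *
        ((∑ ν, n ν * ξ ν) * m μ - n μ * (∑ ν, m ν * ξ ν)) -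
      (∑ ν, ξ ν * dualVec V ν) * ((∑ ν, n ν * τ ν) * m μ - n μ * (∑ ν, m ν * τ ν)) = 0 := by
    rw [hξ, hτ]; ring
  simp [Fin.sum_univ_four, dualVec_eq h₁ h₂] at k
  rw [← sub_eq_zero]
  refine eq_zero_of_antisymm (V := fun a b c => V a b c *
      ((∑ μ, n μ * ξ μ) * (∑ μ, m μ * τ μ) - (∑ μ, n μ * τ μ) * (∑ μ, m μ * ξ μ)) -
      ((ξ a * τ b - ξ b * τ a) * (∑ p, ∑ q, n p * m q * V p q c) +
      (ξ b * τ c - ξ c * τ b) * (∑ p, ∑ q, n p * m q * V p q a) +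
      (ξ c * τ a - ξ a * τ c) * (∑ p, ∑ q, n p * m q * V p q b)))
    (fun a b c => ?_) (fun a b c => ?_) ?_ ?_ ?_ ?_ a b c
  · rw [h₁ a b c]; ring
  · rw [h₂ a b c]; ring
  all_goals
    simp only [Fin.sum_univ_four, z₁, z₂, z₃, s 0 1 2, s 0 1 3, s 0 2 3, s 1 2 3]
  · linear_combination k 3
  · linear_combination -k 2
  · linear_combination k 1
  · linear_combination -k 0

lemma trilinear_swap₁₂ (h₁ : ∀ a b c, V b a c = -V a b c) (X Y Z : Fin 4 → ℝ) :
    ∑ a, ∑ b, ∑ c, V a b c * (Y a * X b * Z c) = -∑ a, ∑ b, ∑ c, V a b c * (X a * Y b * Z c) := by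
  rw [Finset.sum_comm]
  simp only [← Finset.sum_neg_distrib]
  refine Finset.sum_congr rfl fun a _ => Finset.sum_congr rfl fun b _ =>
    Finset.sum_congr rfl fun c _ => ?_
  rw [h₁ a b c]; ring

lemma apply_rotate (h₁ : ∀ a b c, V b a c = -V a b c) (h₂ : ∀ a b c, V a c b = -V a b c)
    (a b c : Fin 4) : V b c a = V a b c := by
  rw [h₂, h₁, neg_neg]

lemma trilinear_rotate (h₁ : ∀ a b c, V b a c = -V a b c) (h₂ : ∀ a b c, V a c b = -V a b c)
    (X Y Z : Fin 4 → ℝ) :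
    ∑ a, ∑ b, ∑ c, V a b c * (Z a * X b * Y c) = ∑ a, ∑ b, ∑ c, V a b c * (X a * Y b * Z c) := by
  rw [← sum_rotate fun a b c => V a b c * (X a * Y b * Z c)]
  refine Finset.sum_congr rfl fun a _ => Finset.sum_congr rfl fun b _ =>
    Finset.sum_congr rfl fun c _ => ?_
  rw [apply_rotate h₁ h₂ a b c]; ring

lemma sum_mul_eq_of_dualVec (h₁ : ∀ a b c, V b a c = -V a b c)
    (h₂ : ∀ a b c, V a c b = -V a b c) (hW₁ : ∀ a b c, W b a c = -W a b c)
    (hW₂ : ∀ a b c, W a c b = -W a b c) {ξ τ : Fin 4 → ℝ} (n m : Fin 4 → ℝ)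
    (hξ : ∑ μ, ξ μ * dualVec V μ = 0) (hτ : ∑ μ, τ μ * dualVec V μ = 0) :
    (∑ a, ∑ b, ∑ c, W a b c * V a b c) *
      ((∑ μ, n μ * ξ μ) * (∑ μ, m μ * τ μ) - (∑ μ, n μ * τ μ) * (∑ μ, m μ * ξ μ)) =
      6 * ∑ a, ∑ b, ∑ c, W a b c * (ξ a * τ b * ∑ p, ∑ q, n p * m q * V p q c) := by
  set v : Fin 4 → ℝ := fun c => ∑ p, ∑ q, n p * m q * V p q c with hv
  calc _ = ∑ a, ∑ b, ∑ c, W a b c * ((ξ a * τ b - ξ b * τ a) * v c +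
        (ξ b * τ c - ξ c * τ b) * v a + (ξ c * τ a - ξ a * τ c) * v b) := by
        generalize hD : (∑ μ, n μ * ξ μ) * (∑ μ, m μ * τ μ) -
          (∑ μ, n μ * τ μ) * (∑ μ, m μ * ξ μ) = D
        simp only [Finset.sum_mul]
        refine Finset.sum_congr rfl fun a _ => Finset.sum_congr rfl fun b _ =>
          Finset.sum_congr rfl fun c _ => ?_
        rw [mul_assoc, ← hD, mul_eq_of_dualVec h₁ h₂ n m hξ hτ a b c]
    _ = (∑ a, ∑ b, ∑ c, W a b c * (ξ a * τ b * v c)) - (∑ a, ∑ b, ∑ c, W a b c * (τ a * ξ b * v c))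
        + (∑ a, ∑ b, ∑ c, W a b c * (v a * ξ b * τ c))
        - (∑ a, ∑ b, ∑ c, W a b c * (v a * τ b * ξ c))
        + (∑ a, ∑ b, ∑ c, W a b c * (τ a * v b * ξ c))
        - (∑ a, ∑ b, ∑ c, W a b c * (ξ a * v b * τ c)) := by
        simp only [← Finset.sum_add_distrib, ← Finset.sum_sub_distrib]
        refine Finset.sum_congr rfl fun a _ => Finset.sum_congr rfl fun b _ =>
          Finset.sum_congr rfl fun c _ => ?_
        ring
    _ = _ := by
        have rot := trilinear_rotate hW₁ hW₂
        rw [rot ξ τ v, rot τ ξ v, rot v ξ τ, rot ξ τ v, rot v τ ξ, rot τ ξ v,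
          trilinear_swap₁₂ hW₁ ξ τ v]
        ring

end Trilinear

section Raising

variable {G : Matrix (Fin 4) (Fin 4) ℝ} {W : Fin 4 → Fin 4 → Fin 4 → ℝ}

/-- All indices of `W` raised with `G`. -/
def raise (G : Matrix (Fin 4) (Fin 4) ℝ) (W : Fin 4 → Fin 4 → Fin 4 → ℝ) (a b c : Fin 4) : ℝ :=
  ∑ p, ∑ q, ∑ r, G a p * G b q * G c r * W p q r

lemma raise_swap₁₂ (h₁ : ∀ a b c, W b a c = -W a b c) (a b c : Fin 4) :
    raise G W b a c = -raise G W a b c := by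
  simp only [raise]
  rw [Finset.sum_comm]
  simp only [← Finset.sum_neg_distrib]
  refine Finset.sum_congr rfl fun p _ => Finset.sum_congr rfl fun q _ =>
    Finset.sum_congr rfl fun r _ => ?_
  rw [h₁ p q r]; ring

lemma raise_swap₂₃ (h₂ : ∀ a b c, W a c b = -W a b c) (a b c : Fin 4) :
    raise G W a c b = -raise G W a b c := by
  simp only [raise, ← Finset.sum_neg_distrib]
  refine Finset.sum_congr rfl fun p _ => ?_
  rw [Finset.sum_comm]
  refine Finset.sum_congr rfl fun q _ => Finset.sum_congr rfl fun r _ => ?_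
  rw [h₂ p q r]; ring

lemma sum_mul_raise {n m ξ τ : Fin 4 → ℝ} (hn : ∀ p, ∑ a, n a * G a p = ξ p)
    (hm : ∀ p, ∑ a, m a * G a p = τ p) (c : Fin 4) :
    ∑ a, ∑ b, n a * m b * raise G W a b c = ∑ r, G c r * ∑ p, ∑ q, ξ p * τ q * W p q r := by
  simp only [raise, ← hn, ← hm, Finset.mul_sum, Finset.sum_mul]
  simp only [← Finset.sum_product', Finset.univ_product_univ]
  refine Fintype.sum_equiv
    (⟨fun (a, b, p, q, r) => (r, p, q, b, a), fun (r, p, q, b, a) => (a, b, p, q, r),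
      fun _ => rfl, fun _ => rfl⟩ : (Fin 4 × Fin 4 × Fin 4 × Fin 4 × Fin 4) ≃
        (Fin 4 × Fin 4 × Fin 4 × Fin 4 × Fin 4)) _ _ fun i => ?_
  dsimp only [Equiv.coe_fn_mk]
  ring

end Raising

section Killing

variable {g : E4 → Matrix (Fin 4) (Fin 4) ℝ} {X Y ξ τ : E4 → Fin 4 → ℝ} {x : E4}

lemma pd_sum_mul {u v : Fin 4 → E4 → ℝ} (hu : ∀ μ, DifferentiableAt ℝ (u μ) x)
    (hv : ∀ μ, DifferentiableAt ℝ (v μ) x) (i : Fin 4) :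
    pd i (fun y => ∑ μ, u μ y * v μ y) x =
      ∑ μ, (pd i (u μ) x * v μ x + u μ x * pd i (v μ) x) := by
  rw [pd_sum i _ fun μ _ => (hu μ).fun_mul (hv μ)]
  exact Finset.sum_congr rfl fun μ _ => pd_mul i (hu μ) (hv μ)

lemma pd_formOf (hg : ∀ μ ν, DifferentiableAt ℝ (fun y => g y μ ν) x)
    (hY : ∀ μ, DifferentiableAt ℝ (fun y => Y y μ) x) (i μ : Fin 4) :
    pd i (fun y => formOf g Y y μ) x =
      ∑ ν, (pd i (fun y => g y μ ν) x * Y x ν + g x μ ν * pd i (fun y => Y y ν) x) := by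
  exact pd_sum_mul (hg μ) hY i

/-- `L_X Y♭ = 0` if `X` is Killing and `[X, Y] = 0`. -/
lemma lie_formOf_eq_zero (hg : ∀ μ ν, DifferentiableAt ℝ (fun y => g y μ ν) x)
    (hY : ∀ μ, DifferentiableAt ℝ (fun y => Y y μ) x)
    (hK : ∀ μ ν, lieD X g x μ ν = 0)
    (hXY : ∀ μ, ∑ s, (X x s * pd s (fun y => Y y μ) x - Y x s * pd s (fun y => X y μ) x) = 0)
    (μ : Fin 4) :
    ∑ s, (X x s * pd s (fun y => formOf g Y y μ) x +
      formOf g Y x s * pd μ (fun y => X y s) x) = 0 := by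
  have h : ∑ ν, (Y x ν * lieD X g x μ ν + g x μ ν *
      ∑ s, (X x s * pd s (fun y => Y y ν) x - Y x s * pd s (fun y => X y ν) x)) = 0 := by
    simp [hK, hXY]
  rw [← h]
  simp only [pd_formOf hg hY]
  simp only [lieD, formOf, Fin.sum_univ_four]
  ring

/-- The pointwise algebra of `i_τ i_ξ d(n ∧ m) = d ((n ∧ m)(ξ, τ))` for invariant covectors
`n`, `m` and commuting `ξ`, `τ`. -/
lemma contract_dsigma {X Y n m : Fin 4 → ℝ} {dX dY dn dm : Fin 4 → Fin 4 → ℝ}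
    (hXn : ∀ μ, ∑ s, (X s * dn s μ + n s * dX μ s) = 0)
    (hXm : ∀ μ, ∑ s, (X s * dm s μ + m s * dX μ s) = 0)
    (hYn : ∀ μ, ∑ s, (Y s * dn s μ + n s * dY μ s) = 0)
    (hYm : ∀ μ, ∑ s, (Y s * dm s μ + m s * dY μ s) = 0)
    (hXY : ∀ μ, ∑ s, (X s * dY s μ - Y s * dX s μ) = 0) (c : Fin 4) :
    ∑ a, ∑ b, X a * Y b *
        ((dn a b * m c + n b * dm a c - (dn a c * m b + n c * dm a b)) +
          (dn b c * m a + n c * dm b a - (dn b a * m c + n a * dm b c)) +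
          (dn c a * m b + n a * dm c b - (dn c b * m a + n b * dm c a))) =
      ((∑ μ, (dn c μ * X μ + n μ * dX c μ)) * (∑ μ, m μ * Y μ) +
        (∑ μ, n μ * X μ) * (∑ μ, (dm c μ * Y μ + m μ * dY c μ))) -
      ((∑ μ, (dn c μ * Y μ + n μ * dY c μ)) * (∑ μ, m μ * X μ) +
        (∑ μ, n μ * Y μ) * (∑ μ, (dm c μ * X μ + m μ * dX c μ))) := by
  simp only [Fin.sum_univ_four] at *
  linear_combination
    m c * (Y 0 * hXn 0 + Y 1 * hXn 1 + Y 2 * hXn 2 + Y 3 * hXn 3) +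
    (n 0 * Y 0 + n 1 * Y 1 + n 2 * Y 2 + n 3 * Y 3) * hXm c -
    (m 0 * Y 0 + m 1 * Y 1 + m 2 * Y 2 + m 3 * Y 3) * hXn c -
    n c * (Y 0 * hXm 0 + Y 1 * hXm 1 + Y 2 * hXm 2 + Y 3 * hXm 3) +
    (m 0 * X 0 + m 1 * X 1 + m 2 * X 2 + m 3 * X 3) * hYn c +
    n c * (X 0 * hYm 0 + X 1 * hYm 1 + X 2 * hYm 2 + X 3 * hYm 3) -
    m c * (X 0 * hYn 0 + X 1 * hYn 1 + X 2 * hYn 2 + X 3 * hYn 3) -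
    (n 0 * X 0 + n 1 * X 1 + n 2 * X 2 + n 3 * X 3) * hYm c +
    m c * (n 0 * hXY 0 + n 1 * hXY 1 + n 2 * hXY 2 + n 3 * hXY 3) -
    n c * (m 0 * hXY 0 + m 1 * hXY 1 + m 2 * hXY 2 + m 3 * hXY 3)

lemma sum_dsigma_eq (hn : ∀ μ, DifferentiableAt ℝ (fun y => formOf g ξ y μ) x)
    (hm : ∀ μ, DifferentiableAt ℝ (fun y => formOf g τ y μ) x)
    (hξ : ∀ μ, DifferentiableAt ℝ (fun y => ξ y μ) x)
    (hτ : ∀ μ, DifferentiableAt ℝ (fun y => τ y μ) x)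
    (hξξ : ∀ μ, ∑ s, (ξ x s * pd s (fun y => formOf g ξ y μ) x +
      formOf g ξ x s * pd μ (fun y => ξ y s) x) = 0)
    (hξτ : ∀ μ, ∑ s, (ξ x s * pd s (fun y => formOf g τ y μ) x +
      formOf g τ x s * pd μ (fun y => ξ y s) x) = 0)
    (hτξ : ∀ μ, ∑ s, (τ x s * pd s (fun y => formOf g ξ y μ) x +
      formOf g ξ x s * pd μ (fun y => τ y s) x) = 0)
    (hττ : ∀ μ, ∑ s, (τ x s * pd s (fun y => formOf g τ y μ) x +
      formOf g τ x s * pd μ (fun y => τ y s) x) = 0)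
    (hcomm : ∀ μ, ∑ s, (ξ x s * pd s (fun y => τ y μ) x - τ x s * pd s (fun y => ξ y μ) x) = 0)
    (c : Fin 4) :
    ∑ a, ∑ b, ξ x a * τ x b * dsigma g ξ τ x a b c =
      pd c (fun y => (∑ μ, formOf g ξ y μ * ξ y μ) * (∑ μ, formOf g τ y μ * τ y μ) -
        (∑ μ, formOf g ξ y μ * τ y μ) * (∑ μ, formOf g τ y μ * ξ y μ)) x := by
  have hσ (i μ ν : Fin 4) : pd i (fun y => sigmaForm g ξ τ y μ ν) x =
      pd i (fun y => formOf g ξ y μ) x * formOf g τ x ν +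
        formOf g ξ x μ * pd i (fun y => formOf g τ y ν) x -
      (pd i (fun y => formOf g ξ y ν) x * formOf g τ x μ +
        formOf g ξ x ν * pd i (fun y => formOf g τ y μ) x) := by
    simp only [sigmaForm]
    rw [pd_sub i ((hn μ).fun_mul (hm ν)) ((hn ν).fun_mul (hm μ)), pd_mul i (hn μ) (hm ν),
      pd_mul i (hn ν) (hm μ)]
  have hd {u v : E4 → Fin 4 → ℝ} (hu : ∀ μ, DifferentiableAt ℝ (fun y => u y μ) x)
      (hv : ∀ μ, DifferentiableAt ℝ (fun y => v y μ) x) :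
      DifferentiableAt ℝ (fun y => ∑ μ, u y μ * v y μ) x :=
    DifferentiableAt.fun_sum fun μ _ => (hu μ).fun_mul (hv μ)
  have hp {u v : E4 → Fin 4 → ℝ} (hu : ∀ μ, DifferentiableAt ℝ (fun y => u y μ) x)
      (hv : ∀ μ, DifferentiableAt ℝ (fun y => v y μ) x) :
      pd c (fun y => ∑ μ, u y μ * v y μ) x =
        ∑ μ, (pd c (fun y => u y μ) x * v x μ + u x μ * pd c (fun y => v y μ) x) := by
    exact pd_sum_mul hu hv c
  rw [pd_sub c ((hd hn hξ).fun_mul (hd hm hτ)) ((hd hn hτ).fun_mul (hd hm hξ)),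
    pd_mul c (hd hn hξ) (hd hm hτ), pd_mul c (hd hn hτ) (hd hm hξ),
    hp hn hξ, hp hm hτ, hp hn hτ, hp hm hξ]
  simp only [dsigma, hσ]
  exact contract_dsigma (dX := fun i μ => pd i (fun y => ξ y μ) x)
    (dY := fun i μ => pd i (fun y => τ y μ) x) (dn := fun i μ => pd i (fun y => formOf g ξ y μ) x)
    (dm := fun i μ => pd i (fun y => formOf g τ y μ) x) hξξ hξτ hτξ hττ hcomm c

end Killing

section Geometry

variable {g : E4 → Matrix (Fin 4) (Fin 4) ℝ} {ξ τ : E4 → Fin 4 → ℝ} {x : E4}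

lemma ipg_eq_sum_formOf (X Y : E4 → Fin 4 → ℝ) : ipg g X Y x = ∑ μ, formOf g Y x μ * X x μ := by
  simp only [ipg, formOf, Finset.sum_mul]
  exact Finset.sum_congr rfl fun μ _ => Finset.sum_congr rfl fun ν _ => by ring

lemma ipg_comm (hs : (g x).IsSymm) (X Y : E4 → Fin 4 → ℝ) : ipg g X Y x = ipg g Y X x := by
  simp only [ipg]
  rw [Finset.sum_comm]
  refine Finset.sum_congr rfl fun μ _ => Finset.sum_congr rfl fun ν _ => ?_
  rw [hs.apply]; ring

lemma ipg_sq_sub_eq (hs : (g x).IsSymm) :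
    ipg g ξ τ x ^ 2 - ipg g ξ ξ x * ipg g τ τ x =
      -((∑ μ, formOf g ξ x μ * ξ x μ) * (∑ μ, formOf g τ x μ * τ x μ) -
        (∑ μ, formOf g ξ x μ * τ x μ) * (∑ μ, formOf g τ x μ * ξ x μ)) := by
  simp only [← ipg_eq_sum_formOf]
  rw [ipg_comm hs τ ξ]; ring

lemma sum_formOf_mul_ginv (hs : (g x).IsSymm) (hdet : IsUnit (g x).det) (p : Fin 4) :
    ∑ a, formOf g ξ x a * ginv g x a p = ξ x p := by
  have h (ν : Fin 4) : ∑ a, g x a ν * ginv g x a p = if ν = p then 1 else 0 := by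
    rw [← Matrix.one_apply, ← Matrix.mul_nonsing_inv _ hdet, Matrix.mul_apply]
    exact Finset.sum_congr rfl fun a _ => by rw [hs.apply ν a]; rfl
  simp only [formOf, Finset.sum_mul]
  rw [Finset.sum_comm]
  calc _ = ∑ ν, ξ x ν * ∑ a, g x a ν * ginv g x a p := by
        simp only [Finset.mul_sum]
        exact Finset.sum_congr rfl fun ν _ => Finset.sum_congr rfl fun a _ => by ring
    _ = _ := by simp [h]

lemma pd_sigmaForm_swap (i μ ν : Fin 4) :
    pd i (fun y => sigmaForm g ξ τ y ν μ) x = -pd i (fun y => sigmaForm g ξ τ y μ ν) x := by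
  rw [← pd_neg]
  congr 1
  funext y
  simp only [sigmaForm]; ring

lemma dsigma_swap₁₂ (a b c : Fin 4) : dsigma g ξ τ x b a c = -dsigma g ξ τ x a b c := by
  simp only [dsigma]
  rw [pd_sigmaForm_swap b c a, pd_sigmaForm_swap a b c, pd_sigmaForm_swap c a b]; ring

lemma dsigma_swap₂₃ (a b c : Fin 4) : dsigma g ξ τ x a c b = -dsigma g ξ τ x a b c := by
  simp only [dsigma]
  rw [pd_sigmaForm_swap a b c, pd_sigmaForm_swap c a b, pd_sigmaForm_swap b c a]; ring

lemma dsigmaUp_swap₁₂ (a b c : Fin 4) : dsigmaUp g ξ τ x b a c = -dsigmaUp g ξ τ x a b c :=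
  raise_swap₁₂ dsigma_swap₁₂ a b c

lemma dsigmaUp_swap₂₃ (a b c : Fin 4) : dsigmaUp g ξ τ x a c b = -dsigmaUp g ξ τ x a b c :=
  raise_swap₂₃ dsigma_swap₂₃ a b c

lemma sum_sigmaForm_mul_dsigmaUp (a : Fin 4) :
    ∑ p, ∑ q, sigmaForm g ξ τ x p q * dsigmaUp g ξ τ x a p q =
      2 * ∑ p, ∑ q, formOf g ξ x p * formOf g τ x q * dsigmaUp g ξ τ x p q a := by
  have h : ∑ p, ∑ q, formOf g ξ x q * formOf g τ x p * dsigmaUp g ξ τ x a p q =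
      -∑ p, ∑ q, formOf g ξ x p * formOf g τ x q * dsigmaUp g ξ τ x a p q := by
    rw [Finset.sum_comm]
    simp only [← Finset.sum_neg_distrib]
    refine Finset.sum_congr rfl fun p _ => Finset.sum_congr rfl fun q _ => ?_
    rw [dsigmaUp_swap₂₃]; ring
  simp only [apply_rotate dsigmaUp_swap₁₂ dsigmaUp_swap₂₃ a]
  simp only [sigmaForm, sub_mul, Finset.sum_sub_distrib, h]
  ring

lemma sum_pd_sigmaForm_mul_dsigmaUp :
    ∑ a, ∑ p, ∑ q, pd a (fun y => sigmaForm g ξ τ y p q) x * dsigmaUp g ξ τ x a p q =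
      1 / 3 * ∑ a, ∑ p, ∑ q, dsigma g ξ τ x a p q * dsigmaUp g ξ τ x a p q := by
  set T : Fin 4 → Fin 4 → Fin 4 → ℝ := fun a p q =>
    pd a (fun y => sigmaForm g ξ τ y p q) x * dsigmaUp g ξ τ x a p q with hT
  have h : ∑ a, ∑ p, ∑ q, dsigma g ξ τ x a p q * dsigmaUp g ξ τ x a p q =
      ∑ a, ∑ p, ∑ q, T a p q + ∑ a, ∑ p, ∑ q, T p q a + ∑ a, ∑ p, ∑ q, T q a p := by
    simp only [← Finset.sum_add_distrib]
    refine Finset.sum_congr rfl fun a _ => Finset.sum_congr rfl fun p _ =>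
      Finset.sum_congr rfl fun q _ => ?_
    have r := apply_rotate (V := dsigmaUp g ξ τ x) dsigmaUp_swap₁₂ dsigmaUp_swap₂₃
    simp only [hT, dsigma]
    rw [← r q a p, r a p q]; ring
  rw [h, sum_rotate T, ← sum_rotate (fun a p q => T q a p)]
  change ∑ a, ∑ p, ∑ q, T a p q = _
  ring

lemma sum_dsigma_mul_dsigmaUp (hs : (g x).IsSymm) (hdet : IsUnit (g x).det)
    (hintξ : ∑ μ, ξ x μ * star3 g (dsigma g ξ τ) x μ = 0)
    (hintτ : ∑ μ, τ x μ * star3 g (dsigma g ξ τ) x μ = 0) :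
    (∑ a, ∑ b, ∑ c, dsigma g ξ τ x a b c * dsigmaUp g ξ τ x a b c) *
      (ipg g ξ τ x ^ 2 - ipg g ξ ξ x * ipg g τ τ x) =
      -6 * ∑ c, ∑ r, ginv g x c r * (∑ a, ∑ b, ξ x a * τ x b * dsigma g ξ τ x a b c) *
        (∑ a, ∑ b, ξ x a * τ x b * dsigma g ξ τ x a b r) := by
  have hv : vol g x ≠ 0 := Real.sqrt_ne_zero'.mpr (abs_pos.mpr hdet.ne_zero)
  have hstar (μ : Fin 4) : star3 g (dsigma g ξ τ) x μ = vol g x * dualVec (dsigmaUp g ξ τ x) μ := by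
    simp only [star3, dualVec, dsigmaUp]; ring
  have hdual {X : Fin 4 → ℝ} (h : ∑ μ, X μ * star3 g (dsigma g ξ τ) x μ = 0) :
      ∑ μ, X μ * dualVec (dsigmaUp g ξ τ x) μ = 0 := by
    refine (mul_eq_zero.mp ?_).resolve_left hv
    rw [← h, Finset.mul_sum]
    exact Finset.sum_congr rfl fun μ _ => by rw [hstar]; ring
  have hraise := sum_mul_raise (W := dsigma g ξ τ x)
    (sum_formOf_mul_ginv (ξ := ξ) hs hdet) (sum_formOf_mul_ginv (ξ := τ) hs hdet)
  rw [ipg_sq_sub_eq hs, mul_neg, sum_mul_eq_of_dualVec dsigmaUp_swap₁₂ dsigmaUp_swap₂₃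
    dsigma_swap₁₂ dsigma_swap₂₃ _ _ (hdual hintξ) (hdual hintτ), neg_mul]
  congr 2
  change ∑ a, ∑ b, ∑ c, _ * (_ * ∑ p, ∑ q, _ * raise (ginv g x) (dsigma g ξ τ x) p q c) = _
  simp only [hraise]
  generalize hw : (fun c => ∑ a, ∑ b, ξ x a * τ x b * dsigma g ξ τ x a b c) = w
  simp only [funext_iff] at hw
  simp only [hw]
  rw [← sum_rotate fun a b c =>
    dsigma g ξ τ x a b c * (ξ x a * τ x b * ∑ r, ginv g x c r * w r)]
  refine Finset.sum_congr rfl fun c _ => ?_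
  calc _ = w c * ∑ r, ginv g x c r * w r := by
        simp only [← hw c, Finset.sum_mul]
        exact Finset.sum_congr rfl fun a _ => Finset.sum_congr rfl fun b _ => by ring
    _ = _ := by
        rw [Finset.mul_sum]
        exact Finset.sum_congr rfl fun r _ => by ring

end Geometry

theorem rho_harmonic
    (Ω : Set E4) (hΩ : IsOpen Ω)
    (g : E4 → Matrix (Fin 4) (Fin 4) ℝ) (ξ τ : E4 → Fin 4 → ℝ)
    (hgsm : ∀ μ ν, ContDiffOn ℝ (⊤ : ℕ∞) (fun y => g y μ ν) Ω)
    (hξsm : ∀ μ, ContDiffOn ℝ (⊤ : ℕ∞) (fun y => ξ y μ) Ω)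
    (hτsm : ∀ μ, ContDiffOn ℝ (⊤ : ℕ∞) (fun y => τ y μ) Ω)
    (hgsymm : ∀ x ∈ Ω, (g x).IsSymm)
    (hgnd : ∀ x ∈ Ω, IsUnit (g x).det)
    -- `ξ` and `τ` are Killing fields
    (hKillξ : ∀ x ∈ Ω, ∀ μ ν, lieD ξ g x μ ν = 0)
    (hKillτ : ∀ x ∈ Ω, ∀ μ ν, lieD τ g x μ ν = 0)
    -- `[ξ, τ] = 0`
    (hcomm : ∀ x ∈ Ω, ∀ μ,
      (∑ s, (ξ x s * pd s (fun y => τ y μ) x - τ x s * pd s (fun y => ξ y μ) x)) = 0)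
    -- `ρ² = −‖σ‖² > 0`
    (hρpos : ∀ x ∈ Ω, 0 < ipg g ξ τ x ^ 2 - ipg g ξ ξ x * ipg g τ τ x)
    -- integrability of the orthogonal distribution: `i_ξ ∗dσ = i_τ ∗dσ = 0`
    (hintξ : ∀ x ∈ Ω, ∑ μ, ξ x μ * star3 g (dsigma g ξ τ) x μ = 0)
    (hintτ : ∀ x ∈ Ω, ∑ μ, τ x μ * star3 g (dsigma g ξ τ) x μ = 0)
    -- the hypothesis `σ · δdσ = 0`
    (hσδdσ : ∀ x ∈ Ω,
      (1 / 2) * ∑ b, ∑ c, sigmaForm g ξ τ x b c * deltaDsigmaUp g ξ τ x b c = 0) :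
    -- conclusion: `Δ_g ρ = ρ^{-1} ‖dρ‖²`
    ∀ x ∈ Ω, lapBeltrami g (rhoF g ξ τ) x =
      (rhoF g ξ τ x)⁻¹ *
        ∑ a, ∑ b, ginv g x a b * pd a (rhoF g ξ τ) x * pd b (rhoF g ξ τ) x := by
  have sm {f : E4 → ℝ} (hf : ContDiffOn ℝ (⊤ : ℕ∞) f Ω) {y : E4} (hy : y ∈ Ω) :
      ContDiffAt ℝ ∞ f y := hf.contDiffAt (hΩ.mem_nhds hy)
  have df {f : E4 → ℝ} {y : E4} (hf : ContDiffAt ℝ ∞ f y) : DifferentiableAt ℝ f y :=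
    hf.differentiableAt (by simp)
  have hform {X : E4 → Fin 4 → ℝ} (hX : ∀ μ, ContDiffOn ℝ (⊤ : ℕ∞) (fun y => X y μ) Ω)
      {y : E4} (hy : y ∈ Ω) (μ : Fin 4) : ContDiffAt ℝ ∞ (fun y => formOf g X y μ) y :=
    contDiffAt_formOf (fun μ ν => sm (hgsm μ ν) hy) (fun μ => sm (hX μ) hy) μ
  have hipg {X Y : E4 → Fin 4 → ℝ} (hX : ∀ μ, ContDiffOn ℝ (⊤ : ℕ∞) (fun y => X y μ) Ω)
      (hY : ∀ μ, ContDiffOn ℝ (⊤ : ℕ∞) (fun y => Y y μ) Ω)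
      {y : E4} (hy : y ∈ Ω) : ContDiffAt ℝ ∞ (ipg g X Y) y :=
    ContDiffAt.sum fun μ _ => ContDiffAt.sum fun ν _ =>
      ((sm (hgsm μ ν) hy).mul (sm (hX μ) hy)).mul (sm (hY ν) hy)
  have hF {y : E4} (hy : y ∈ Ω) : ContDiffAt ℝ ∞
      (fun y => ipg g ξ τ y ^ 2 - ipg g ξ ξ y * ipg g τ τ y) y :=
    ((hipg hξsm hτsm hy).pow 2).sub ((hipg hξsm hξsm hy).mul (hipg hτsm hτsm hy))
  have hρ {y : E4} (hy : y ∈ Ω) : ContDiffAt ℝ ∞ (rhoF g ξ τ) y :=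
    (hF hy).sqrt (hρpos y hy).ne'
  have hρ0 {y : E4} (hy : y ∈ Ω) : 0 < rhoF g ξ τ y := Real.sqrt_pos.mpr (hρpos y hy)
  have hdρ {y : E4} (hy : y ∈ Ω) (c : Fin 4) :
      ∑ a, ∑ b, ξ y a * τ y b * dsigma g ξ τ y a b c =
        -(2 * rhoF g ξ τ y * pd c (rhoF g ξ τ) y) := by
    have dg (μ ν : Fin 4) := df (sm (hgsm μ ν) hy)
    have dξ (μ : Fin 4) := df (sm (hξsm μ) hy)
    have dτ (μ : Fin 4) := df (sm (hτsm μ) hy)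
    have hanti {u v : Fin 4 → Fin 4 → ℝ} {μ : Fin 4} {X Y : Fin 4 → ℝ}
        (h : ∑ s, (X s * u s μ - Y s * v s μ) = 0) : ∑ s, (Y s * v s μ - X s * u s μ) = 0 := by
      rw [← neg_eq_zero, ← h, ← Finset.sum_neg_distrib]
      exact Finset.sum_congr rfl fun s _ => by ring
    rw [sum_dsigma_eq (fun μ => df (hform hξsm hy μ)) (fun μ => df (hform hτsm hy μ)) dξ dτ
      (lie_formOf_eq_zero dg dξ (hKillξ y hy) fun μ => by simp)
      (lie_formOf_eq_zero dg dτ (hKillξ y hy) (hcomm y hy))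
      (lie_formOf_eq_zero dg dξ (hKillτ y hy) fun μ =>
        hanti (u := fun s μ => pd s (fun z => τ z μ) y) (v := fun s μ => pd s (fun z => ξ z μ) y)
          (hcomm y hy μ))
      (lie_formOf_eq_zero dg dτ (hKillτ y hy) fun μ => by simp) (hcomm y hy)]
    have hsqrt : pd c (rhoF g ξ τ) y = _ := pd_sqrt c (df (hF hy)) (hρpos y hy).ne'
    change _ = _ / (2 * rhoF g ξ τ y) at hsqrt
    rw [hsqrt, mul_div_cancel₀ _ (by have := hρ0 hy; positivity), ← pd_neg]
    refine pd_congr c ?_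
    filter_upwards [hΩ.mem_nhds hy] with z hz
    rw [ipg_sq_sub_eq (hgsymm z hz), neg_neg]
  have hflux {y : E4} (hy : y ∈ Ω) (a : Fin 4) :
      rhoF g ξ τ y * (vol g y * ∑ b, ginv g y a b * pd b (rhoF g ξ τ) y) =
        ∑ p, ∑ q, (-1 / 4 * sigmaForm g ξ τ y p q) * (vol g y * dsigmaUp g ξ τ y a p q) := by
    have h₁ : ∑ p, ∑ q, (-1 / 4 * sigmaForm g ξ τ y p q) * (vol g y * dsigmaUp g ξ τ y a p q) =
        -1 / 4 * vol g y * ∑ p, ∑ q, sigmaForm g ξ τ y p q * dsigmaUp g ξ τ y a p q := by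
      simp only [Finset.mul_sum]
      exact Finset.sum_congr rfl fun p _ => Finset.sum_congr rfl fun q _ => by ring
    have h₂ := sum_mul_raise (W := dsigma g ξ τ y)
      (sum_formOf_mul_ginv (ξ := ξ) (hgsymm y hy) (hgnd y hy))
      (sum_formOf_mul_ginv (ξ := τ) (hgsymm y hy) (hgnd y hy)) a
    change ∑ p, ∑ q, _ * dsigmaUp g ξ τ y p q a = _ at h₂
    rw [h₁, sum_sigmaForm_mul_dsigmaUp, h₂]
    simp only [hdρ hy, Finset.mul_sum]
    exact Finset.sum_congr rfl fun b _ => by ring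
  intro x hx
  have hgx (μ ν : Fin 4) := sm (hgsm μ ν) hx
  have hdet := (hgnd x hx).ne_zero
  have hv : vol g x ≠ 0 := Real.sqrt_ne_zero'.mpr (abs_pos.mpr hdet)
  have hvol := contDiffAt_vol hgx hdet
  have hV (a p q : Fin 4) : DifferentiableAt ℝ (fun y => vol g y * dsigmaUp g ξ τ y a p q) x :=
    df (hvol.mul (contDiffAt_dsigmaUp hgx hdet (fun μ => sm (hξsm μ) hx)
      (fun μ => sm (hτsm μ) hx) a p q))
  have hσ (p q : Fin 4) : DifferentiableAt ℝ (fun y => sigmaForm g ξ τ y p q) x :=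
    df (contDiffAt_sigmaForm hgx (fun μ => sm (hξsm μ) hx) (fun μ => sm (hτsm μ) hx) p q)
  have hY (a : Fin 4) : DifferentiableAt ℝ
      (fun y => vol g y * ∑ b, ginv g y a b * pd b (rhoF g ξ τ) y) x :=
    df (hvol.mul (ContDiffAt.sum fun b _ =>
      (contDiffAt_ginv hgx hdet a b).mul (contDiffAt_pd b (hρ hx))))
  have hdiv (a : Fin 4) :
      pd a (rhoF g ξ τ) x * (vol g x * ∑ b, ginv g x a b * pd b (rhoF g ξ τ) x) +
        rhoF g ξ τ x * pd a (fun y => vol g y * ∑ b, ginv g y a b * pd b (rhoF g ξ τ) y) x =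
      ∑ p, ∑ q, (-1 / 4 * pd a (fun y => sigmaForm g ξ τ y p q) x *
          (vol g x * dsigmaUp g ξ τ x a p q) +
        -1 / 4 * sigmaForm g ξ τ x p q * pd a (fun y => vol g y * dsigmaUp g ξ τ y a p q) x) := by
    have hc (p q : Fin 4) : DifferentiableAt ℝ (fun y => -1 / 4 * sigmaForm g ξ τ y p q) x :=
      (hσ p q).const_mul _
    rw [← pd_mul a (df (hρ hx)) (hY a),
      pd_congr a (Filter.eventually_of_mem (hΩ.mem_nhds hx) fun y hy => hflux hy a),
      pd_sum a _ fun p _ => DifferentiableAt.fun_sum fun q _ => (hc p q).fun_mul (hV a p q)]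
    refine Finset.sum_congr rfl fun p _ => ?_
    rw [pd_sum_mul (hc p) (hV a p)]
    refine Finset.sum_congr rfl fun q _ => ?_
    rw [pd_mul a (differentiableAt_const _) (hσ p q)]
    simp [pd]
  have hN := sum_dsigma_mul_dsigmaUp (hgsymm x hx) (hgnd x hx) (hintξ x hx) (hintτ x hx)
  have hρsq : ipg g ξ τ x ^ 2 - ipg g ξ ξ x * ipg g τ τ x = rhoF g ξ τ x ^ 2 :=
    (Real.sq_sqrt (hρpos x hx).le).symm
  rw [hρsq] at hN
  simp only [hdρ hx] at hN
  set N := ∑ a, ∑ b, ginv g x a b * pd a (rhoF g ξ τ) x * pd b (rhoF g ξ τ) x with hNdef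
  set P := ∑ a, pd a (fun y => vol g y * ∑ b, ginv g y a b * pd b (rhoF g ξ τ) y) x with hP
  have hρx := (hρ0 hx).ne'
  have hS : ∑ a, ∑ b, ∑ c, dsigma g ξ τ x a b c * dsigmaUp g ξ τ x a b c = -24 * N := by
    refine mul_right_cancel₀ (pow_ne_zero 2 hρx) (hN.trans ?_)
    simp only [hNdef, Finset.mul_sum, Finset.sum_mul]
    exact Finset.sum_congr rfl fun a _ => Finset.sum_congr rfl fun b _ => by ring
  have hδ : ∑ p, ∑ q, sigmaForm g ξ τ x p q *
      ∑ a, pd a (fun y => vol g y * dsigmaUp g ξ τ y a p q) x = 0 := by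
    refine (mul_eq_zero.mp ((hσδdσ x hx).symm.trans ?_).symm).resolve_left
      (mul_ne_zero (by norm_num : (-1 / 2 : ℝ) ≠ 0) (inv_ne_zero hv))
    simp only [deltaDsigmaUp]
    rw [Finset.mul_sum, Finset.mul_sum]
    refine Finset.sum_congr rfl fun p _ => ?_
    rw [Finset.mul_sum, Finset.mul_sum]
    exact Finset.sum_congr rfl fun q _ => by ring
  have hleft : ∑ a, (pd a (rhoF g ξ τ) x * (vol g x * ∑ b, ginv g x a b * pd b (rhoF g ξ τ) x) +
      rhoF g ξ τ x * pd a (fun y => vol g y * ∑ b, ginv g y a b * pd b (rhoF g ξ τ) y) x) =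
      vol g x * N + rhoF g ξ τ x * P := by
    rw [Finset.sum_add_distrib, ← Finset.mul_sum, hNdef, add_left_inj]
    simp only [Finset.mul_sum]
    exact Finset.sum_congr rfl fun a _ => Finset.sum_congr rfl fun b _ => by ring
  have hright : ∑ a, ∑ p, ∑ q, (-1 / 4 * pd a (fun y => sigmaForm g ξ τ y p q) x *
          (vol g x * dsigmaUp g ξ τ x a p q) +
        -1 / 4 * sigmaForm g ξ τ x p q * pd a (fun y => vol g y * dsigmaUp g ξ τ y a p q) x) =
      -1 / 4 * vol g x * (∑ a, ∑ p, ∑ q, pd a (fun y => sigmaForm g ξ τ y p q) x *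
        dsigmaUp g ξ τ x a p q) + -1 / 4 * ∑ p, ∑ q, sigmaForm g ξ τ x p q *
          ∑ a, pd a (fun y => vol g y * dsigmaUp g ξ τ y a p q) x := by
    have h := sum_rotate fun p q a => sigmaForm g ξ τ x p q *
      pd a (fun y => vol g y * dsigmaUp g ξ τ y a p q) x
    simp only [← Finset.mul_sum] at h
    rw [← h]
    simp only [Finset.mul_sum, ← Finset.sum_add_distrib]
    exact Finset.sum_congr rfl fun a _ => Finset.sum_congr rfl fun p _ =>
      Finset.sum_congr rfl fun q _ => by ring
  rw [← Finset.sum_congr rfl fun a _ => hdiv a, hleft, sum_pd_sigmaForm_mul_dsigmaUp, hS, hδ]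
    at hright
  simp only [lapBeltrami]
  rw [← hP]
  field_simp
  linarith
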